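/- arXiv:1008.3443 — 2 statements merged into one kernel-verified Lean document; each statement's English description precedes it below -/
import Mathlib

section
/- Let 𝒞 be a partition of V that is submodular for μ_t (t > 0) with |𝒞| ≥ 2, assume the graph G (with edge (l,r) iff m(l,r)>0) is connected, and let c* be the minimum over nonempty proper subsets S ⊂ V of Σ_{l∈S, r∉S} m(l,r). Then for every C ∈ 𝒞, c*/(tZ) < m_V(C) < 1 − c*/(tZ), and |𝒞| < tZ/c*. -/
open Finset

variable {V : Type*} [Fintype V] [DecidableEq V]

noncomputable section

/-- `Z = ∑_{l,r} m(l,r)` as a real number. -/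
def Zval (m : V → V → ℕ) : ℝ := ∑ l : V, ∑ r : V, (m l r : ℝ)

/-- The probability measure `m_E` on `V × V`. -/
def mE (m : V → V → ℕ) (S : Finset (V × V)) : ℝ :=
  (∑ p ∈ S, (m p.1 p.2 : ℝ)) / Zval m

/-- The marginal probability `m_V` on `V`. -/
def mV (m : V → V → ℕ) (A : Finset V) : ℝ := mE m (A ×ˢ Finset.univ)

/-- The product measure `m_VV` on `V × V`. -/
def mVV (m : V → V → ℕ) (S : Finset (V × V)) : ℝ :=
  ∑ p ∈ S, mV m {p.1} * mV m {p.2}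

/-- The signed measure `μ_t = m_E - t · m_VV`. -/
def mu (m : V → V → ℕ) (t : ℝ) (S : Finset (V × V)) : ℝ := mE m S - t * mVV m S

/-- `ρ(C) = m_E(C × (V ∖ C))`. -/
def rho (m : V → V → ℕ) (C : Finset V) : ℝ := mE m (C ×ˢ (Finset.univ \ C))

/-- A partition of `V`: pairwise disjoint nonempty sets covering `V`. -/
def IsPartition (𝒞 : Finset (Finset V)) : Prop :=
  (∀ C ∈ 𝒞, C.Nonempty) ∧
  (∀ C ∈ 𝒞, ∀ C' ∈ 𝒞, C ≠ C' → Disjoint C C') ∧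
  𝒞.sup id = Finset.univ

/-- The diagonal set `D(𝒞) = ∪_{C ∈ 𝒞} C × C`. -/
def Dset (𝒞 : Finset (Finset V)) : Finset (V × V) := 𝒞.sup fun C => C ×ˢ C

/-- The modularity at resolution `t`: `Q_t(𝒞) = μ_t(D(𝒞))`. -/
def Qmod (m : V → V → ℕ) (t : ℝ) (𝒞 : Finset (Finset V)) : ℝ := mu m t (Dset 𝒞)

/-- The complement `Q̄_t(𝒞) = μ_t(D̄(𝒞))`. -/
def Qbar (m : V → V → ℕ) (t : ℝ) (𝒞 : Finset (Finset V)) : ℝ :=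
  mu m t (Finset.univ \ Dset 𝒞)

/-- `𝒞` is submodular for `μ_t`: `μ_t(C × C') ≤ 0` for distinct `C, C' ∈ 𝒞`. -/
def Submodular (m : V → V → ℕ) (t : ℝ) (𝒞 : Finset (Finset V)) : Prop :=
  ∀ C ∈ 𝒞, ∀ C' ∈ 𝒞, C ≠ C' → mu m t (C ×ˢ C') ≤ 0

/-- `Coarsens 𝒞 𝒟` means `𝒞 ⪯ 𝒟`, i.e. `𝒟` refines `𝒞`:
every element of `𝒞` is the union of the elements of `𝒟` it contains. -/
def Coarsens (𝒞 𝒟 : Finset (Finset V)) : Prop :=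
  ∀ C ∈ 𝒞, C = (𝒟.filter fun D => D ⊆ C).sup id

/-- The resolution `t(𝒞)`: the maximum of `m_E(C×C') / m_VV(C×C')` over distinct
pairs of parts (`0` when there are no such pairs, e.g. `|𝒞| = 1`). -/
def resol (m : V → V → ℕ) (𝒞 : Finset (Finset V)) : ℝ :=
  ⨆ p : {p : Finset V × Finset V // p.1 ∈ 𝒞 ∧ p.2 ∈ 𝒞 ∧ p.1 ≠ p.2},
    mE m ((p : Finset V × Finset V).1 ×ˢ (p : Finset V × Finset V).2) /
      mVV m ((p : Finset V × Finset V).1 ×ˢ (p : Finset V × Finset V).2)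

/-- The graph `G` associated to `m`: an edge between `l ≠ r` iff `m(l,r) > 0`
(for symmetric `m` this is exactly the graph of the paper). -/
def graphOf (m : V → V → ℕ) : SimpleGraph V :=
  SimpleGraph.fromRel fun l r => 0 < m l r

/-- `α(𝒞) = m_VV(D(𝒞)) = ∑_{C ∈ 𝒞} m_V(C)²`. -/
def alphaP (m : V → V → ℕ) (𝒞 : Finset (Finset V)) : ℝ := mVV m (Dset 𝒞)

open scoped Classical in
/-- `Z₀(𝒞)` at resolution `t`: the pairs of distinct parts with `μ_t(C × C') = 0`. -/
def Z0 (m : V → V → ℕ) (t : ℝ) (𝒞 : Finset (Finset V)) :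
    Finset (Finset V × Finset V) :=
  (𝒞 ×ˢ 𝒞).filter fun p => p.1 ≠ p.2 ∧ mu m t (p.1 ×ˢ p.2) = 0

/-- The value `c*` of the minimum cut of `G` with weights `m`. -/
def mincut (m : V → V → ℕ) : ℝ :=
  ⨅ S : {S : Finset V // S.Nonempty ∧ S ≠ Finset.univ},
    ∑ l ∈ (S : Finset V), ∑ r ∈ Finset.univ \ (S : Finset V), (m l r : ℝ)

end

set_option linter.unusedSectionVars false

theorem mV_eq_sum (m : V → V → ℕ) (A : Finset V) : mV m A = ∑ l ∈ A, mV m {l} := by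
  simp only [mV, mE, sum_product, sum_singleton, sum_div]

theorem mVV_product (m : V → V → ℕ) (A B : Finset V) :
    mVV m (A ×ˢ B) = mV m A * mV m B := by
  rw [mVV, sum_product, mV_eq_sum m A, mV_eq_sum m B, sum_mul_sum]

theorem mu_eq_sum (m : V → V → ℕ) (t : ℝ) (S : Finset (V × V)) :
    mu m t S = ∑ p ∈ S, ((m p.1 p.2 : ℝ) / Zval m - t * (mV m {p.1} * mV m {p.2})) := by
  rw [mu, mE, mVV, sum_sub_distrib, sum_div, mul_sum]

theorem Zval_pos {m : V → V → ℕ} (hZ : 0 < ∑ l : V, ∑ r : V, m l r) : 0 < Zval m := by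
  unfold Zval
  exact_mod_cast hZ

theorem mV_univ {m : V → V → ℕ} (hZ : 0 < ∑ l : V, ∑ r : V, m l r) :
    mV m Finset.univ = 1 := by
  rw [mV, mE, sum_product]
  exact div_self (Zval_pos hZ).ne'

theorem mV_pos {m : V → V → ℕ} (hZ : 0 < ∑ l : V, ∑ r : V, m l r)
    (hdeg : ∀ l : V, 0 < ∑ r : V, m l r) {A : Finset V} (hA : A.Nonempty) :
    0 < mV m A := by
  rw [mV, mE, sum_product]
  refine div_pos (sum_pos (fun l _ => ?_) hA) (Zval_pos hZ)
  exact_mod_cast hdeg l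

theorem mV_add_mV_compl {m : V → V → ℕ} (hZ : 0 < ∑ l : V, ∑ r : V, m l r)
    (A : Finset V) : mV m A + mV m (Finset.univ \ A) = 1 := by
  rw [← mV_univ hZ, mV_eq_sum m A, mV_eq_sum m (Finset.univ \ A), mV_eq_sum m Finset.univ,
    add_comm, sum_sdiff (subset_univ A)]

theorem IsPartition.biUnion_eq_univ {𝒞 : Finset (Finset V)} (h : IsPartition 𝒞) :
    𝒞.biUnion id = Finset.univ := by
  rw [← sup_eq_biUnion, h.2.2]

theorem IsPartition.sum_mV {m : V → V → ℕ} (hZ : 0 < ∑ l : V, ∑ r : V, m l r)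
    {𝒞 : Finset (Finset V)} (h : IsPartition 𝒞) : ∑ C ∈ 𝒞, mV m C = 1 := by
  rw [← mV_univ hZ, mV_eq_sum m Finset.univ, ← h.biUnion_eq_univ,
    sum_biUnion (t := id) fun C hC C' hC' hne => h.2.1 C hC C' hC' hne]
  exact sum_congr rfl fun C _ => mV_eq_sum m C

theorem IsPartition.compl_eq_biUnion {𝒞 : Finset (Finset V)} (h : IsPartition 𝒞)
    {C : Finset V} (hC : C ∈ 𝒞) : Finset.univ \ C = (𝒞.erase C).biUnion id := by
  ext x
  simp only [mem_sdiff, mem_univ, true_and, mem_biUnion, mem_erase, id]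
  constructor
  · intro hx
    have hmem : x ∈ 𝒞.biUnion id := h.biUnion_eq_univ ▸ mem_univ x
    obtain ⟨D, hD, hxD⟩ := mem_biUnion.mp hmem
    exact ⟨D, ⟨fun hDC => hx (hDC ▸ hxD), hD⟩, hxD⟩
  · rintro ⟨D, ⟨hne, hD⟩, hxD⟩ hxC
    exact disjoint_left.mp (h.2.1 D hD C hC hne) hxD hxC

theorem IsPartition.mu_product_compl_nonpos {m : V → V → ℕ} {t : ℝ}
    {𝒞 : Finset (Finset V)} (h : IsPartition 𝒞) (hsub : Submodular m t 𝒞)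
    {C : Finset V} (hC : C ∈ 𝒞) : mu m t (C ×ˢ (Finset.univ \ C)) ≤ 0 := by
  rw [h.compl_eq_biUnion hC, mu_eq_sum, sum_product_right, sum_biUnion]
  · refine sum_nonpos fun D hD => ?_
    have hD' := mem_erase.mp hD
    have := hsub C hC D hD'.2 hD'.1.symm
    rwa [mu_eq_sum, sum_product_right] at this
  · intro D hD D' hD' hne
    exact h.2.1 D (mem_of_mem_erase hD) D' (mem_of_mem_erase hD') hne

theorem IsPartition.ne_univ {𝒞 : Finset (Finset V)} (h : IsPartition 𝒞)
    (hcard : 2 ≤ 𝒞.card) {C : Finset V} (hC : C ∈ 𝒞) : C ≠ Finset.univ := by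
  rintro rfl
  obtain ⟨D, hD, hne⟩ := exists_mem_ne hcard Finset.univ
  obtain ⟨x, hx⟩ := h.1 D hD
  exact disjoint_left.mp (h.2.1 D hD _ hC hne) hx (mem_univ x)

theorem mincut_le (m : V → V → ℕ) {S : Finset V} (hS : S.Nonempty) (hS' : S ≠ Finset.univ) :
    mincut m ≤ ∑ l ∈ S, ∑ r ∈ Finset.univ \ S, (m l r : ℝ) :=
  ciInf_le (Set.finite_range fun S : {S : Finset V // S.Nonempty ∧ S ≠ Finset.univ} =>
    ∑ l ∈ (S : Finset V), ∑ r ∈ Finset.univ \ (S : Finset V), (m l r : ℝ)).bddBelow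
    (⟨S, hS, hS'⟩ : {S : Finset V // S.Nonempty ∧ S ≠ Finset.univ})

theorem cut_pos {m : V → V → ℕ} (hsym : ∀ l r, m l r = m r l)
    (hconn : (graphOf m).Connected) {S : Finset V} (hS : S.Nonempty)
    (hS' : S ≠ Finset.univ) : 0 < ∑ l ∈ S, ∑ r ∈ Finset.univ \ S, (m l r : ℝ) := by
  obtain ⟨u, hu⟩ := hS
  obtain ⟨v, hv⟩ : ∃ v, v ∉ S := by
    by_contra! hall
    exact hS' (eq_univ_iff_forall.mpr hall)
  obtain ⟨w⟩ := hconn.preconnected u v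
  obtain ⟨d, -, hd, hd'⟩ := w.exists_boundary_dart (S : Set V) hu hv
  have hadj := (SimpleGraph.fromRel_adj _ _ _).mp d.adj
  rw [hsym d.snd d.fst, or_self] at hadj
  refine sum_pos' (fun l _ => sum_nonneg fun r _ => Nat.cast_nonneg _) ⟨d.fst, hd, ?_⟩
  refine sum_pos' (fun r _ => Nat.cast_nonneg _) ⟨d.snd, ?_, ?_⟩
  · simpa using hd'
  · exact_mod_cast hadj.2

theorem mincut_pos {m : V → V → ℕ} (hsym : ∀ l r, m l r = m r l)
    (hconn : (graphOf m).Connected) {S : Finset V} (hS : S.Nonempty)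
    (hS' : S ≠ Finset.univ) : 0 < mincut m := by
  have : Nonempty {S : Finset V // S.Nonempty ∧ S ≠ Finset.univ} := ⟨⟨S, hS, hS'⟩⟩
  obtain ⟨T, hT⟩ := exists_eq_ciInf_of_finite
    (f := fun S : {S : Finset V // S.Nonempty ∧ S ≠ Finset.univ} =>
      ∑ l ∈ (S : Finset V), ∑ r ∈ Finset.univ \ (S : Finset V), (m l r : ℝ))
  rw [mincut, ← hT]
  exact cut_pos hsym hconn T.2.1 T.2.2

theorem IsPartition.mincut_div_le {m : V → V → ℕ} (hZ : 0 < ∑ l : V, ∑ r : V, m l r)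
    {𝒞 : Finset (Finset V)} (h : IsPartition 𝒞) {t : ℝ} (ht : 0 < t)
    (hsub : Submodular m t 𝒞) (hcard : 2 ≤ 𝒞.card) {C : Finset V} (hC : C ∈ 𝒞) :
    mincut m / (t * Zval m) ≤ mV m C * (1 - mV m C) := by
  have hmu := h.mu_product_compl_nonpos hsub hC
  have hcut := mincut_le m (h.1 C hC) (h.ne_univ hcard hC)
  have hZ' := Zval_pos hZ
  rw [mu, mVV_product, mE, sum_product, eq_sub_of_add_eq' (mV_add_mV_compl hZ C),
    sub_nonpos, div_le_iff₀ hZ'] at hmu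
  rw [div_le_iff₀ (mul_pos ht hZ')]
  linarith

/-- If `𝒞` is a partition of `V` submodular for `μ_t` (`t > 0`)
with `|𝒞| ≥ 2`, `G` is connected and `c*` is the minimum cut value, then for every
`C ∈ 𝒞`, `c*/(tZ) < m_V(C) < 1 − c*/(tZ)`, and `|𝒞| < tZ/c*`. -/
theorem stmt_14 (m : V → V → ℕ) (hsym : ∀ l r, m l r = m r l)
    (hZ : 0 < ∑ l : V, ∑ r : V, m l r) (hdeg : ∀ l : V, 0 < ∑ r : V, m l r)
    (𝒞 : Finset (Finset V)) (h𝒞 : IsPartition 𝒞) (t : ℝ) (ht : 0 < t)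
    (hsub : Submodular m t 𝒞) (hcard : 2 ≤ 𝒞.card)
    (hconn : (graphOf m).Connected) :
    (∀ C ∈ 𝒞, mincut m / (t * Zval m) < mV m C ∧
      mV m C < 1 - mincut m / (t * Zval m)) ∧
    (𝒞.card : ℝ) < t * Zval m / mincut m := by
  have hbound : ∀ C ∈ 𝒞, mincut m / (t * Zval m) < mV m C ∧
      mV m C < 1 - mincut m / (t * Zval m) := by
    intro C hC
    have hle := h𝒞.mincut_div_le hZ ht hsub hcard hC
    have hpos := mV_pos hZ hdeg (h𝒞.1 C hC)
    have hlt : 0 < 1 - mV m C := by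
      rw [← eq_sub_of_add_eq' (mV_add_mV_compl hZ C)]
      exact mV_pos hZ hdeg (sdiff_nonempty.mpr fun hsubset =>
        h𝒞.ne_univ hcard hC (univ_subset_iff.mp hsubset))
    constructor <;> nlinarith [mul_pos hpos hpos, mul_pos hlt hlt]
  refine ⟨hbound, ?_⟩
  have hne : 𝒞.Nonempty := card_pos.mp (by lia)
  obtain ⟨C, hC⟩ := hne
  have hc := mincut_pos hsym hconn (h𝒞.1 C hC) (h𝒞.ne_univ hcard hC)
  have hsum : ∑ _C ∈ 𝒞, mincut m / (t * Zval m) < 1 :=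
    (sum_lt_sum_of_nonempty ⟨C, hC⟩ fun D hD => (hbound D hD).1).trans_eq (h𝒞.sum_mV hZ)
  rw [sum_const, nsmul_eq_mul, ← mul_div_assoc,
    div_lt_one (mul_pos ht (Zval_pos hZ))] at hsum
  rwa [lt_div_iff₀ hc]
end

section
/- If 𝒞 and 𝒟 are partitions of V with 𝒞 ⪯ 𝒟 (i.e. 𝒟 refines 𝒞), then t(𝒞) ≤ t(𝒟); in particular t(𝒞) ≤ t(𝒞₁), where 𝒞₁ is the partition of V into singletons. -/
open Finset

variable {V : Type*} [Fintype V] [DecidableEq V]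

theorem mE_nonneg (m : V → V → ℕ) (S : Finset (V × V)) : 0 ≤ mE m S := by
  unfold mE Zval
  positivity

theorem mV_singleton_pos {m : V → V → ℕ} (hZ : 0 < ∑ l : V, ∑ r : V, m l r)
    (hdeg : ∀ l : V, 0 < ∑ r : V, m l r) (l : V) : 0 < mV m {l} := by
  unfold mV mE
  refine div_pos ?_ (Zval_pos hZ)
  rw [Finset.sum_product, Finset.sum_singleton]
  exact_mod_cast hdeg l

theorem mVV_nonneg (m : V → V → ℕ) (S : Finset (V × V)) : 0 ≤ mVV m S :=
  Finset.sum_nonneg fun _ _ => mul_nonneg (mE_nonneg _ _) (mE_nonneg _ _)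

theorem mVV_pos {m : V → V → ℕ} (hZ : 0 < ∑ l : V, ∑ r : V, m l r)
    (hdeg : ∀ l : V, 0 < ∑ r : V, m l r) {S : Finset (V × V)} (hS : S.Nonempty) :
    0 < mVV m S :=
  Finset.sum_pos
    (fun p _ => mul_pos (mV_singleton_pos hZ hdeg p.1) (mV_singleton_pos hZ hdeg p.2)) hS

theorem resol_nonneg (m : V → V → ℕ) (𝒞 : Finset (Finset V)) : 0 ≤ resol m 𝒞 :=
  Real.iSup_nonneg fun _ => div_nonneg (mE_nonneg _ _) (mVV_nonneg _ _)

/-- A partition is submodular at its own resolution. -/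
theorem submodular_resol {m : V → V → ℕ} (hZ : 0 < ∑ l : V, ∑ r : V, m l r)
    (hdeg : ∀ l : V, 0 < ∑ r : V, m l r) {𝒟 : Finset (Finset V)}
    (h𝒟 : ∀ D ∈ 𝒟, D.Nonempty) : Submodular m (resol m 𝒟) 𝒟 := by
  intro D hD D' hD' hne
  have h := le_ciSup
    (f := fun p : {p : Finset V × Finset V // p.1 ∈ 𝒟 ∧ p.2 ∈ 𝒟 ∧ p.1 ≠ p.2} =>
      mE m (p.1.1 ×ˢ p.1.2) / mVV m (p.1.1 ×ˢ p.1.2))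
    (Set.finite_range _).bddAbove ⟨(D, D'), hD, hD', hne⟩
  exact sub_nonpos.2 ((div_le_iff₀ (mVV_pos hZ hdeg ((h𝒟 D hD).product (h𝒟 D' hD')))).1 h)

theorem resol_le_of_submodular {m : V → V → ℕ} {t : ℝ} (ht : 0 ≤ t)
    {𝒞 : Finset (Finset V)} (h : Submodular m t 𝒞) : resol m 𝒞 ≤ t :=
  Real.iSup_le (fun p => div_le_of_le_mul₀ (mVV_nonneg _ _) ht
    (sub_nonpos.1 (h _ p.2.1 _ p.2.2.1 p.2.2.2))) ht

theorem sum_eq_sum_filter_of_coarsens {𝒞 𝒟 : Finset (Finset V)} (h𝒟 : IsPartition 𝒟)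
    (href : Coarsens 𝒞 𝒟) {C : Finset V} (hC : C ∈ 𝒞) (f : V → ℝ) :
    ∑ v ∈ C, f v = ∑ D ∈ 𝒟.filter (fun D => D ⊆ C), ∑ v ∈ D, f v := by
  conv_lhs => rw [href C hC, Finset.sup_eq_biUnion]
  refine Finset.sum_biUnion fun D hD D' hD' hne => ?_
  exact h𝒟.2.1 D (Finset.mem_filter.1 hD).1 D' (Finset.mem_filter.1 hD').1 hne

theorem Submodular.coarsen {m : V → V → ℕ} {t : ℝ} {𝒞 𝒟 : Finset (Finset V)}
    (h𝒞 : IsPartition 𝒞) (h𝒟 : IsPartition 𝒟) (href : Coarsens 𝒞 𝒟)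
    (h : Submodular m t 𝒟) : Submodular m t 𝒞 := by
  intro C hC C' hC' hne
  rw [mu_eq_sum, Finset.sum_product, sum_eq_sum_filter_of_coarsens h𝒟 href hC]
  refine Finset.sum_nonpos fun D hD => ?_
  rw [Finset.sum_comm, sum_eq_sum_filter_of_coarsens h𝒟 href hC']
  refine Finset.sum_nonpos fun D' hD' => ?_
  rw [Finset.sum_comm, ← Finset.sum_product D D' fun p : V × V =>
    (m p.1 p.2 : ℝ) / Zval m - t * (mV m {p.1} * mV m {p.2}), ← mu_eq_sum]
  rw [Finset.mem_filter] at hD hD'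
  refine h D hD.1 D' hD'.1 ?_
  rintro rfl
  obtain ⟨v, hv⟩ := h𝒟.1 D hD.1
  exact Finset.disjoint_left.1 (h𝒞.2.1 C hC C' hC' hne) (hD.2 hv) (hD'.2 hv)

theorem resol_mono {m : V → V → ℕ} (hZ : 0 < ∑ l : V, ∑ r : V, m l r)
    (hdeg : ∀ l : V, 0 < ∑ r : V, m l r) {𝒞 𝒟 : Finset (Finset V)}
    (h𝒞 : IsPartition 𝒞) (h𝒟 : IsPartition 𝒟) (href : Coarsens 𝒞 𝒟) :
    resol m 𝒞 ≤ resol m 𝒟 :=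
  resol_le_of_submodular (resol_nonneg m 𝒟)
    ((submodular_resol hZ hdeg h𝒟.1).coarsen h𝒞 h𝒟 href)

theorem isPartition_singletons :
    IsPartition (Finset.univ.image fun v : V => ({v} : Finset V)) := by
  refine ⟨by simp, ?_, ?_⟩
  · simp [eq_comm]
  · ext v
    simp

theorem coarsens_singletons (𝒞 : Finset (Finset V)) :
    Coarsens 𝒞 (Finset.univ.image fun v : V => ({v} : Finset V)) := by
  intro C _
  ext v
  simp [Finset.mem_sup]

/-- If `𝒞 ⪯ 𝒟` (i.e. `𝒟` refines `𝒞`) then `t(𝒞) ≤ t(𝒟)`;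
in particular `t(𝒞) ≤ t(𝒞₁)` where `𝒞₁` is the partition into singletons. -/
theorem stmt_16 (m : V → V → ℕ) (hsym : ∀ l r, m l r = m r l)
    (hZ : 0 < ∑ l : V, ∑ r : V, m l r) (hdeg : ∀ l : V, 0 < ∑ r : V, m l r)
    (𝒞 𝒟 : Finset (Finset V)) (h𝒞 : IsPartition 𝒞) (h𝒟 : IsPartition 𝒟)
    (href : Coarsens 𝒞 𝒟) :
    resol m 𝒞 ≤ resol m 𝒟 ∧
    resol m 𝒞 ≤ resol m (Finset.univ.image fun v : V => ({v} : Finset V)) := by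
  exact ⟨resol_mono hZ hdeg h𝒞 h𝒟 href,
    resol_mono hZ hdeg h𝒞 isPartition_singletons (coarsens_singletons 𝒞)⟩
end
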